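/- arXiv:1803.00411 — 4 statements merged into one kernel-verified Lean document; each statement's English description precedes it below -/
import Mathlib

section
/- Let X be a nonempty complete metric space and let f₁, …, f_N : X → X (with N ≥ 1) be contraction maps, i.e. for each i there is λᵢ ∈ [0,1) with dist(fᵢ(x), fᵢ(y)) ≤ λᵢ · dist(x, y) for all x, y ∈ X. Then there exists a unique nonempty compact set A ⊆ X such that A = ⋃_{i=1}^{N} fᵢ(A) (where fᵢ(A) denotes the image of A under fᵢ). -/
open TopologicalSpace Metric Set
open scoped NNReal ENNReal

/-- The image map induced on nonempty compact sets by a `K`-Lipschitz map is `K`-Lipschitz for the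
Hausdorff distance. -/
theorem LipschitzWith.nonemptyCompacts_map {X Y : Type*} [EMetricSpace X] [EMetricSpace Y]
    {K : ℝ≥0} {f : X → Y} (hf : LipschitzWith K f) :
    LipschitzWith K (NonemptyCompacts.map f hf.continuous) := by
  have key (S T : NonemptyCompacts X) : ∀ y ∈ f '' (S : Set X),
      ∃ z ∈ f '' (T : Set X), edist y z ≤ K * hausdorffEDist (S : Set X) T := by
    rintro _ ⟨x, hx, rfl⟩
    obtain ⟨z, hz, hxz⟩ := T.isCompact.exists_infEDist_eq_edist T.nonempty x
    refine ⟨f z, mem_image_of_mem f hz, (hf x z).trans ?_⟩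
    rw [← hxz]
    gcongr
    exact infEDist_le_hausdorffEDist_of_mem hx
  intro S T
  change hausdorffEDist (f '' (S : Set X)) (f '' (T : Set X)) ≤
    K * hausdorffEDist (S : Set X) T
  refine hausdorffEDist_le_of_mem_edist (key S T) ?_
  rw [hausdorffEDist_comm]
  exact key T S

/-- The Hutchinson operator `S ↦ ⋃ i, f i '' S` of a nonempty finite family of continuous maps,
acting on nonempty compact sets. -/
def hutchinsonOperator {ι X : Type*} [Finite ι] [Nonempty ι] [TopologicalSpace X]
    (f : ι → X → X) (hf : ∀ i, Continuous (f i)) (S : NonemptyCompacts X) :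
    NonemptyCompacts X where
  carrier := ⋃ i, f i '' S
  isCompact' := isCompact_iUnion fun i => S.isCompact.image (hf i)
  nonempty' := nonempty_iUnion.2 ⟨Classical.arbitrary ι, S.nonempty.image _⟩

theorem LipschitzWith.hutchinsonOperator {ι X : Type*} [Finite ι] [Nonempty ι] [EMetricSpace X]
    {K : ℝ≥0} {f : ι → X → X} (hf : ∀ i, LipschitzWith K (f i)) :
    LipschitzWith K (hutchinsonOperator f fun i => (hf i).continuous) := fun S T =>
  hausdorffEDist_iUnion_le.trans <| iSup_le fun i => (hf i).nonemptyCompacts_map S T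

/-- Hutchinson's theorem (existence and uniqueness of the attractor):
for an IFS of contraction maps on a nonempty complete metric space, there is a
unique nonempty compact set `A` with `A = ⋃ i, f i '' A`. -/
theorem hutchinson_exists_unique_attractor
    {X : Type*} [MetricSpace X] [CompleteSpace X] [Nonempty X]
    (N : ℕ) (hN : 1 ≤ N) (f : Fin N → X → X)
    (hf : ∀ i : Fin N, ∃ L : ℝ, 0 ≤ L ∧ L < 1 ∧
      ∀ x y : X, dist (f i x) (f i y) ≤ L * dist x y) :
    ∃! A : Set X, A.Nonempty ∧ IsCompact A ∧ A = ⋃ i : Fin N, f i '' A := by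
  choose L hL0 hL1 hL using hf
  have : Nonempty (Fin N) := ⟨⟨0, hN⟩⟩
  let K : ℝ≥0 := Finset.univ.sup fun i => (L i).toNNReal
  have hK : K < 1 := (Finset.sup_lt_iff one_pos).2 fun i _ => Real.toNNReal_lt_one.2 (hL1 i)
  have hLip (i : Fin N) : LipschitzWith K (f i) :=
    (LipschitzWith.of_dist_le' (hL i)).weaken
      (Finset.le_sup (f := fun i => (L i).toNNReal) (Finset.mem_univ i))
  have hF : ContractingWith K (hutchinsonOperator f fun i => (hLip i).continuous) :=
    ⟨hK, LipschitzWith.hutchinsonOperator hLip⟩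
  have : Nonempty (NonemptyCompacts X) := ⟨{Classical.arbitrary X}⟩
  let A := hF.fixedPoint
  refine ⟨A, ⟨A.nonempty, A.isCompact, ?_⟩, ?_⟩
  · exact congrArg (fun S : NonemptyCompacts X => (S : Set X)) hF.fixedPoint_isFixedPt.symm
  · rintro B ⟨hBne, hBc, hB⟩
    have hfix : Function.IsFixedPt (hutchinsonOperator f fun i => (hLip i).continuous)
        ⟨⟨B, hBc⟩, hBne⟩ := NonemptyCompacts.ext hB.symm
    exact congrArg (fun S : NonemptyCompacts X => (S : Set X)) (hF.fixedPoint_unique hfix)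
end

section
/- Let X be a nonempty complete metric space and let f₁, …, f_N : X → X (with N ≥ 1) be contraction maps with Lipschitz constants λᵢ < 1, and let A be the unique nonempty compact set with A = ⋃_{i=1}^{N} fᵢ(A). Then for every nonempty compact set S ⊆ X, the iterates Fᵏ(S) converge to A in the Hausdorff metric as k → ∞, where F(S) = ⋃_{i=1}^{N} fᵢ(S). -/
/-- The union of the images under a family of `L`-Lipschitz maps contracts one-sided distances
between sets by the factor `L`. -/
theorem exists_dist_le_mul_of_mem_iUnion_image {X ι : Type*} [PseudoMetricSpace X]
    {f : ι → X → X} {L r : ℝ} (hL : 0 ≤ L)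
    (hf : ∀ i x y, dist (f i x) (f i y) ≤ L * dist x y) {s t : Set X}
    (h : ∀ x ∈ s, ∃ y ∈ t, dist x y ≤ r) :
    ∀ x ∈ ⋃ i, f i '' s, ∃ y ∈ ⋃ i, f i '' t, dist x y ≤ L * r := by
  intro _ hx
  obtain ⟨i, x, hxs, rfl⟩ := Set.mem_iUnion.1 hx
  obtain ⟨y, hy, hxy⟩ := h x hxs
  exact ⟨f i y, Set.mem_iUnion.2 ⟨i, y, hy, rfl⟩,
    (hf i x y).trans (mul_le_mul_of_nonneg_left hxy hL)⟩

/-- Finitely many contractions have a common contraction factor. -/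
theorem exists_common_contraction_factor {X ι : Type*} [PseudoMetricSpace X] [Finite ι]
    [Nonempty ι] {f : ι → X → X}
    (hf : ∀ i, ∃ L : ℝ, 0 ≤ L ∧ L < 1 ∧ ∀ x y, dist (f i x) (f i y) ≤ L * dist x y) :
    ∃ L : ℝ, 0 ≤ L ∧ L < 1 ∧ ∀ i x y, dist (f i x) (f i y) ≤ L * dist x y := by
  choose L hL0 hL1 hL using hf
  obtain ⟨j, hj⟩ := Finite.exists_max L
  exact ⟨L j, hL0 j, hL1 j, fun i x y =>
    (hL i x y).trans (mul_le_mul_of_nonneg_right (hj i) dist_nonneg)⟩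

/-- Hutchinson's theorem (convergence part): for an IFS of contraction maps on a
nonempty complete metric space with attractor `A`, the iterates `F^[k] S` of any
nonempty compact set `S` converge to `A` in the Hausdorff metric. -/
theorem hutchinson_tendsto_attractor
    {X : Type*} [MetricSpace X] [CompleteSpace X] [Nonempty X]
    (N : ℕ) (hN : 1 ≤ N) (f : Fin N → X → X)
    (hf : ∀ i : Fin N, ∃ L : ℝ, 0 ≤ L ∧ L < 1 ∧
      ∀ x y : X, dist (f i x) (f i y) ≤ L * dist x y)
    (A : Set X) (hAne : A.Nonempty) (hAc : IsCompact A)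
    (hAfix : A = ⋃ i : Fin N, f i '' A)
    (S : Set X) (hSne : S.Nonempty) (hSc : IsCompact S) :
    Filter.Tendsto
      (fun k : ℕ => Metric.hausdorffDist ((fun T : Set X => ⋃ i : Fin N, f i '' T)^[k] S) A)
      Filter.atTop (nhds 0) := by
  have : Nonempty (Fin N) := ⟨⟨0, hN⟩⟩
  obtain ⟨L, hL0, hL1, hL⟩ := exists_common_contraction_factor hf
  obtain ⟨C, hC⟩ := Metric.isBounded_iff.1 (hSc.isBounded.union hAc.isBounded)
  obtain ⟨a, ha⟩ := hAne
  obtain ⟨b, hb⟩ := hSne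
  have hC0 : 0 ≤ C := dist_nonneg.trans (hC (Or.inl hb) (Or.inr ha))
  set F : Set X → Set X := fun T => ⋃ i : Fin N, f i '' T
  have key : ∀ k : ℕ, (∀ x ∈ F^[k] S, ∃ y ∈ A, dist x y ≤ L ^ k * C) ∧
      ∀ y ∈ A, ∃ x ∈ F^[k] S, dist y x ≤ L ^ k * C := by
    intro k
    induction k with
    | zero =>
      simp only [Function.iterate_zero, id_eq, pow_zero, one_mul]
      exact ⟨fun x hx => ⟨a, ha, hC (Or.inl hx) (Or.inr ha)⟩,
        fun y hy => ⟨b, hb, hC (Or.inr hy) (Or.inl hb)⟩⟩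
    | succ k ih =>
      rw [Function.iterate_succ_apply', pow_succ', mul_assoc, show A = F A from hAfix]
      exact ⟨exists_dist_le_mul_of_mem_iUnion_image hL0 hL ih.1,
        exists_dist_le_mul_of_mem_iUnion_image hL0 hL ih.2⟩
  have hlim : Filter.Tendsto (fun k : ℕ => L ^ k * C) Filter.atTop (nhds 0) := by
    simpa using (tendsto_pow_atTop_nhds_zero_of_lt_one hL0 hL1).mul_const C
  exact squeeze_zero (fun _ => Metric.hausdorffDist_nonneg)
    (fun k => Metric.hausdorffDist_le_of_mem_dist (by positivity) (key k).1 (key k).2) hlim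
end

section
/- For every ε > 0, there exist a, b > 0 satisfying the strict triangle inequalities a + b > 1, a < b + 1, b < a + 1 and with a² + b² > 1, together with a real number d such that (b/(a² + b²))^d + (a/(a² + b²))^d + ((a² + b² − 1)/(a² + b²))^d = 1 and 1 < d < 1 + ε. That is, obtuse △FFN generalised Sierpinski triangles can have fractal dimension arbitrarily close to 1. -/
/-- If `x ≤ t` and `t ^ e = c`, then `x ^ (1 + e)` is at most `c` times `x`. -/
lemma rpow_one_add_le_mul {x t e c : ℝ} (hx : 0 < x) (hxt : x ≤ t) (he : 0 ≤ e)
    (hc : t ^ e = c) : x ^ (1 + e) ≤ x * c := by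
  rw [Real.rpow_add hx, Real.rpow_one, ← hc]
  gcongr

/-- Moran's equation for three positive ratios has a solution in `(p, q)` as soon as the
power sum crosses `1` there. -/
lemma exists_moran_exponent {x y z p q : ℝ} (hx : 0 < x) (hy : 0 < y) (hz : 0 < z)
    (hpq : p ≤ q) (hp : 1 < x ^ p + y ^ p + z ^ p) (hq : x ^ q + y ^ q + z ^ q < 1) :
    ∃ d : ℝ, x ^ d + y ^ d + z ^ d = 1 ∧ p < d ∧ d < q := by
  have hcont : Continuous fun d : ℝ => x ^ d + y ^ d + z ^ d :=
    ((Real.continuous_const_rpow hx.ne').add (Real.continuous_const_rpow hy.ne')).add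
      (Real.continuous_const_rpow hz.ne')
  obtain ⟨d, ⟨hd₁, hd₂⟩, hd⟩ := intermediate_value_Ioo' hpq hcont.continuousOn ⟨hq, hp⟩
  exact ⟨d, hd, hd₁, hd₂⟩

/-- Obtuse △FFN generalised Sierpinski triangles can have fractal dimension
arbitrarily close to 1: for every `ε > 0` there are admissible side lengths `a`, `b`
with `a² + b² > 1` whose Moran dimension `d` satisfies `1 < d < 1 + ε`. -/
theorem FFN_dimension_near_one :
    ∀ ε : ℝ, 0 < ε →
      ∃ a b d : ℝ, 0 < a ∧ 0 < b ∧ 1 < a + b ∧ a < b + 1 ∧ b < a + 1 ∧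
        1 < a ^ 2 + b ^ 2 ∧
        (b / (a ^ 2 + b ^ 2)) ^ d + (a / (a ^ 2 + b ^ 2)) ^ d +
          ((a ^ 2 + b ^ 2 - 1) / (a ^ 2 + b ^ 2)) ^ d = 1 ∧
        1 < d ∧ d < 1 + ε := by
  intro ε hε
  obtain ⟨t, ht₀, ht₁, ht⟩ : ∃ t : ℝ, 0 < t ∧ t ≤ 1 ∧ t ^ ε = 1 / 32 := by
    refine ⟨(1 / 32) ^ ε⁻¹, by positivity, ?_, ?_⟩
    · exact Real.rpow_le_one (by norm_num) (by norm_num) (by positivity)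
    · rw [← Real.rpow_mul (by norm_num), inv_mul_cancel₀ hε.ne', Real.rpow_one]
  obtain ⟨b, hbt⟩ : ∃ b : ℝ, t = 9 / 4 * b := ⟨4 / 9 * t, by ring⟩
  have hb₀ : 0 < b := by linarith
  have hb₁ : b ≤ 1 := by linarith
  obtain ⟨a, ha⟩ : ∃ a : ℝ, a = 1 + b / 2 := ⟨_, rfl⟩
  obtain ⟨s, hs⟩ : ∃ s : ℝ, s = a ^ 2 + b ^ 2 := ⟨_, rfl⟩
  have hs' : s = 1 + b + 5 / 4 * b ^ 2 := by rw [hs, ha]; ring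
  have hbb : b ^ 2 ≤ b := by nlinarith
  have hs₁ : 1 < s := by nlinarith
  have hs₀ : 0 < s := by linarith
  have ha₀ : 0 < a := by linarith
  have hα₀ : 0 < b / s := by positivity
  have hβ₀ : 0 < a / s := by positivity
  have hγ₀ : 0 < (s - 1) / s := div_pos (by linarith) hs₀
  have hα : b / s ≤ b := div_le_self hb₀.le hs₁.le
  have hβ : a / s ≤ 1 - b / 8 := by
    rw [div_le_iff₀ hs₀]
    nlinarith
  have hγ : (s - 1) / s ≤ t := (div_le_self (by linarith) hs₁.le).trans (by linarith)
  have hp : 1 < (b / s) ^ (1 : ℝ) + (a / s) ^ (1 : ℝ) + ((s - 1) / s) ^ (1 : ℝ) := by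
    simp only [Real.rpow_one]
    rw [← add_div, ← add_div, one_lt_div hs₀]
    linarith
  have hq : (b / s) ^ (1 + ε) + (a / s) ^ (1 + ε) + ((s - 1) / s) ^ (1 + ε) < 1 := by
    have h₁ := rpow_one_add_le_mul hα₀ (by linarith) hε.le ht
    have h₂ := rpow_one_add_le_mul hγ₀ hγ hε.le ht
    have h₃ : (a / s) ^ (1 + ε) ≤ a / s :=
      Real.rpow_le_self_of_le_one hβ₀.le (by linarith) (by linarith)
    linarith
  obtain ⟨d, hd, hd₁, hd₂⟩ := exists_moran_exponent hα₀ hβ₀ hγ₀ (by linarith) hp hq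
  refine ⟨a, b, d, ha₀, hb₀, by linarith, by linarith, by linarith, ?_, ?_, hd₁, hd₂⟩
  · rwa [← hs]
  · rwa [← hs]
end

section
/- There exist a, b > 0 satisfying the strict triangle inequalities a + b > 1, a < b + 1, b < a + 1 and with a² + b² > 1, together with a real number d > 0, such that (b/(a² + b²))^d + (a/(a² + b²))^d + ((a² + b² − 1)/(a² + b²))^d = 1 and d < log 3 / log 2. That is, there are △FFN generalised Sierpinski triangles whose fractal dimension is strictly below the Sierpinski dimension log 3 / log 2. -/
theorem Real.rpow_three_halves_le {x y : ℝ} (hx : 0 ≤ x) (hy : 0 ≤ y) (h : x ^ 3 ≤ y ^ 2) :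
    x ^ (3 / 2 : ℝ) ≤ y := by
  refine le_of_sq_le_sq ?_ hy
  rw [← Real.rpow_mul_natCast hx]
  norm_num
  exact_mod_cast h

theorem Real.three_halves_lt_log_three_div_log_two :
    (3 / 2 : ℝ) < Real.log 3 / Real.log 2 := by
  rw [lt_div_iff₀ (Real.log_pos one_lt_two)]
  have h : Real.log ((2 : ℝ) ^ 3) < Real.log ((3 : ℝ) ^ 2) :=
    Real.log_lt_log (by norm_num) (by norm_num)
  rw [Real.log_pow, Real.log_pow] at h
  push_cast at h
  linarith

/-- There are △FFN generalised Sierpinski triangles whose fractal dimension is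
strictly below the Sierpinski dimension `log 3 / log 2`. -/
theorem FFN_dimension_below_sierpinski :
    ∃ a b d : ℝ, 0 < a ∧ 0 < b ∧ 1 < a + b ∧ a < b + 1 ∧ b < a + 1 ∧
      1 < a ^ 2 + b ^ 2 ∧ 0 < d ∧
      (b / (a ^ 2 + b ^ 2)) ^ d + (a / (a ^ 2 + b ^ 2)) ^ d +
        ((a ^ 2 + b ^ 2 - 1) / (a ^ 2 + b ^ 2)) ^ d = 1 ∧
      d < Real.log 3 / Real.log 2 := by
  have hcont : Continuous fun d : ℝ =>
      (22 / 25 : ℝ) ^ d + (4 / 25 : ℝ) ^ d + (1 / 5 : ℝ) ^ d :=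
    ((Real.continuous_const_rpow (by norm_num)).add
      (Real.continuous_const_rpow (by norm_num))).add
      (Real.continuous_const_rpow (by norm_num))
  have h₁ : (22 / 25 : ℝ) ^ (3 / 2 : ℝ) ≤ 83 / 100 :=
    Real.rpow_three_halves_le (by norm_num) (by norm_num) (by norm_num)
  have h₂ : (4 / 25 : ℝ) ^ (3 / 2 : ℝ) ≤ 8 / 125 :=
    Real.rpow_three_halves_le (by norm_num) (by norm_num) (by norm_num)
  have h₃ : (1 / 5 : ℝ) ^ (3 / 2 : ℝ) ≤ 9 / 100 :=
    Real.rpow_three_halves_le (by norm_num) (by norm_num) (by norm_num)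
  obtain ⟨d, ⟨hd₁, hd₂⟩, hd⟩ :=
    intermediate_value_Icc' (by norm_num : (1 : ℝ) ≤ 3 / 2) hcont.continuousOn
      (show (1 : ℝ) ∈ Set.Icc _ _ from
        ⟨by linarith, by simp only [Real.rpow_one]; norm_num⟩)
  refine ⟨1 / 5, 11 / 10, d, by norm_num, by norm_num, by norm_num, by norm_num, by norm_num,
    by norm_num, by linarith, ?_, hd₂.trans_lt Real.three_halves_lt_log_three_div_log_two⟩
  rw [show (11 / 10 : ℝ) / ((1 / 5) ^ 2 + (11 / 10) ^ 2) = 22 / 25 by norm_num,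
    show (1 / 5 : ℝ) / ((1 / 5) ^ 2 + (11 / 10) ^ 2) = 4 / 25 by norm_num,
    show ((1 / 5 : ℝ) ^ 2 + (11 / 10) ^ 2 - 1) / ((1 / 5) ^ 2 + (11 / 10) ^ 2) = 1 / 5 by norm_num]
  exact hd
end
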